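/- Let G=(L,R;E) be a bipartite graph that has at least one identifiable ℓ-subgraph. Then there exists a set J*⊆L such that the ℓ-subgraph G(J*) is identifiable and every set J⊆L for which G(J) is identifiable satisfies J⊆J*. -/

import Mathlib

open Finset

/-- A (bipartitioned) bipartite graph on a finite ambient vertex type `V`:
two disjoint finite vertex sets `L` and `R`, and an adjacency relation
(oriented from `L` to `R`) all of whose edges join a vertex of `L`
to a vertex of `R`. -/
structure BipGraph (V : Type*) [DecidableEq V] [Fintype V] where
  L : Finset V
  R : Finset V
  disj : Disjoint L R
  adj : V → V → Bool
  adj_mem : ∀ u v, adj u v = true → u ∈ L ∧ v ∈ R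

namespace BipGraph

variable {V : Type*} [DecidableEq V] [Fintype V]

/-- `N(X)`: the set of vertices of `R` having a neighbor in `X`. -/
def nbhd (G : BipGraph V) (X : Finset V) : Finset V :=
  G.R.filter (fun r => ∃ x ∈ X, G.adj x r = true)

/-- A matching of `A` into `S`: an injective assignment matching every vertex
of `A` to an adjacent vertex of `S`. -/
def HasMatchingInto (G : BipGraph V) (A S : Finset V) : Prop :=
  ∃ f : V → V, Set.InjOn f ↑A ∧ ∀ a ∈ A, f a ∈ S ∧ G.adj a (f a) = true

/-- `G = (L,R;E)` is identifiable if `E ≠ ∅` and for every `v ∈ L` there is a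
matching (necessarily of cardinality `|L| - 1`) of `L \ {v}` into `R \ N(v)`. -/
def Identifiable (G : BipGraph V) : Prop :=
  (∃ u v, G.adj u v = true) ∧
    ∀ v ∈ G.L, G.HasMatchingInto (G.L.erase v) (G.R \ G.nbhd {v})

/-- The ℓ-subgraph of `G` induced by `J ⊆ L`: the induced subgraph
`G[J, R \ N(L \ J)]`. -/
def lSub (G : BipGraph V) (J : Finset V) : BipGraph V where
  L := J ∩ G.L
  R := G.R \ G.nbhd (G.L \ J)
  disj := G.disj.mono inter_subset_right sdiff_subset
  adj := fun u v =>
    decide (u ∈ J ∩ G.L) && decide (v ∈ G.R \ G.nbhd (G.L \ J)) && G.adj u v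
  adj_mem := by
    intro u v h
    simp only [Bool.and_eq_true, decide_eq_true_eq] at h
    exact ⟨h.1.1, h.1.2⟩

end BipGraph

namespace BipGraph

variable {V : Type*} [DecidableEq V] [Fintype V]

/-- Every vertex of `A` can be matched to a vertex all of whose neighbors lie in `S`. -/
def HasInnerMatching (G : BipGraph V) (A S : Finset V) : Prop :=
  ∃ f : V → V, Set.InjOn f ↑A ∧ ∀ a ∈ A, G.adj a (f a) = true ∧ ∀ u, G.adj u (f a) = true → u ∈ S

theorem lSub_adj_iff (G : BipGraph V) (J : Finset V) (u r : V) :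
    (G.lSub J).adj u r = true ↔ G.adj u r = true ∧ ∀ w, G.adj w r = true → w ∈ J := by
  have hL := fun w => G.adj_mem w r
  simp only [lSub, nbhd, Bool.and_eq_true, decide_eq_true_eq, mem_inter, mem_sdiff, mem_filter]
  grind

theorem lSub_hasMatchingInto_iff (G : BipGraph V) {J : Finset V} (A : Finset V) (v : V) :
    (G.lSub J).HasMatchingInto A ((G.lSub J).R \ (G.lSub J).nbhd {v}) ↔
      G.HasInnerMatching A (J.erase v) := by
  refine exists_congr fun f => and_congr_right fun _ => forall₂_congr fun a _ => ?_
  have hR := (G.lSub J).adj_mem a (f a)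
  simp only [mem_sdiff, nbhd, mem_filter, mem_singleton, exists_eq_left, mem_erase]
  simp only [lSub_adj_iff] at hR ⊢
  grind

theorem lSub_identifiable_iff (G : BipGraph V) {J : Finset V} (hJ : J ⊆ G.L) :
    (G.lSub J).Identifiable ↔
      (∃ u r, G.adj u r = true ∧ ∀ w, G.adj w r = true → w ∈ J) ∧
        ∀ v ∈ J, G.HasInnerMatching (J.erase v) (J.erase v) := by
  have hL : (G.lSub J).L = J := inter_eq_left.mpr hJ
  simp only [Identifiable, lSub_adj_iff, lSub_hasMatchingInto_iff, hL]

theorem HasInnerMatching.mono {G : BipGraph V} {A A' S S' : Finset V}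
    (h : G.HasInnerMatching A S) (hA : A' ⊆ A) (hS : S ⊆ S') : G.HasInnerMatching A' S' := by
  obtain ⟨f, hf, h⟩ := h
  exact ⟨f, hf.mono (coe_subset.mpr hA), fun a ha =>
    ⟨(h a (hA ha)).1, fun u hu => hS ((h a (hA ha)).2 u hu)⟩⟩

/-- Vertices matched from outside `S` have a neighbor outside `S`, so the two matchings
use different vertices. -/
theorem HasInnerMatching.union {G : BipGraph V} {A B S T : Finset V}
    (hA : G.HasInnerMatching A S) (hB : G.HasInnerMatching B T) (hd : Disjoint B S) :
    G.HasInnerMatching (A ∪ B) (S ∪ T) := by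
  obtain ⟨f, hf, hfA⟩ := hA
  obtain ⟨g, hg, hgB⟩ := hB
  have hne : ∀ a ∈ A, ∀ b ∈ B, f a ≠ g b := fun a ha b hb hab =>
    disjoint_left.mp hd hb ((hfA a ha).2 b (hab ▸ (hgB b hb).1))
  refine ⟨fun x => if x ∈ A then f x else g x, ?_, ?_⟩
  · intro x hx y hy hxy
    simp only [coe_union, Set.mem_union, mem_coe] at hx hy
    have hf' := @hf x
    have hg' := @hg x
    simp only [mem_coe] at hf' hg'
    grind
  · grind

/-- A vertex of the nonempty neighborhood of `r` can be left out of the matching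
and then matched to `r`. -/
theorem hasInnerMatching_self {G : BipGraph V} {J : Finset V}
    (hE : ∃ u r, G.adj u r = true ∧ ∀ w, G.adj w r = true → w ∈ J)
    (hM : ∀ v ∈ J, G.HasInnerMatching (J.erase v) (J.erase v)) :
    G.HasInnerMatching J J := by
  obtain ⟨u, r, hur, hr⟩ := hE
  have huJ := hr u hur
  obtain ⟨f, hf, hfM⟩ := hM u huJ
  have hne : ∀ a ∈ J.erase u, f a ≠ r := fun a ha har =>
    notMem_erase u J ((hfM a ha).2 u (har ▸ hur))
  refine ⟨fun x => if x = u then r else f x, ?_, ?_⟩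
  · intro x hx y hy hxy
    have hf' := @hf x
    simp only [mem_coe] at hf' hx hy
    grind
  · grind

theorem hasInnerMatching_union_erase {G : BipGraph V} {A B : Finset V} {v : V}
    (hA : ∀ v ∈ A, G.HasInnerMatching (A.erase v) (A.erase v))
    (hEB : ∃ u r, G.adj u r = true ∧ ∀ w, G.adj w r = true → w ∈ B)
    (hB : ∀ v ∈ B, G.HasInnerMatching (B.erase v) (B.erase v)) (hv : v ∈ A) :
    G.HasInnerMatching ((A ∪ B).erase v) ((A ∪ B).erase v) := by
  have hBA : G.HasInnerMatching (B \ A) (B.erase v) := by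
    by_cases hvB : v ∈ B
    · exact (hB v hvB).mono (by grind) Subset.rfl
    · rw [erase_eq_of_notMem hvB]
      exact (hasInnerMatching_self hEB hB).mono sdiff_subset Subset.rfl
  exact ((hA v hv).union hBA (sdiff_disjoint.mono_right (erase_subset v A))).mono
    (by grind) (by grind)

theorem lSub_union_identifiable {G : BipGraph V} {A B : Finset V} (hAL : A ⊆ G.L) (hBL : B ⊆ G.L)
    (hA : (G.lSub A).Identifiable) (hB : (G.lSub B).Identifiable) :
    (G.lSub (A ∪ B)).Identifiable := by
  rw [lSub_identifiable_iff G hAL] at hA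
  rw [lSub_identifiable_iff G hBL] at hB
  rw [lSub_identifiable_iff G (union_subset hAL hBL)]
  constructor
  · obtain ⟨u, r, hur, hr⟩ := hA.1
    exact ⟨u, r, hur, fun w hw => mem_union_left B (hr w hw)⟩
  · intro v hv
    rcases mem_union.mp hv with hv | hv
    · exact hasInnerMatching_union_erase hA.2 hB.1 hB.2 hv
    · rw [union_comm]
      exact hasInnerMatching_union_erase hB.2 hA.1 hA.2 hv

end BipGraph

/-- If a bipartite graph `G` has at least one identifiable ℓ-subgraph, then
there is a set `J* ⊆ L` inducing an identifiable ℓ-subgraph that contains every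
set `J ⊆ L` inducing an identifiable ℓ-subgraph. -/
theorem stmt6 {V : Type*} [DecidableEq V] [Fintype V] (G : BipGraph V)
    (h : ∃ J ⊆ G.L, (G.lSub J).Identifiable) :
    ∃ Jstar ⊆ G.L, (G.lSub Jstar).Identifiable ∧
      ∀ J ⊆ G.L, (G.lSub J).Identifiable → J ⊆ Jstar := by
  obtain ⟨M, hM⟩ := (Set.toFinite {J | J ⊆ G.L ∧ (G.lSub J).Identifiable}).exists_maximal h
  exact ⟨M, hM.prop.1, hM.prop.2, fun J hJL hJ => subset_union_right.trans <|
    hM.le_of_ge ⟨union_subset hM.prop.1 hJL,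
      BipGraph.lSub_union_identifiable hM.prop.1 hJL hM.prop.2 hJ⟩ subset_union_left⟩
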